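/- arXiv:1908.08237 — 2 statements merged into one kernel-verified Lean document; each statement's English description precedes it below -/
import Mathlib

section
/- For every integer t ≥ 1 and every integer n ≥ 5t+2, sbal(n, (2t−1)K_2) = bal(n, 2tK_2); consequently the triple ((2t−1)K_2, 2tK_2, (2t+1)K_2) has the triple property: there is n₀ such that for all n ≥ n₀, sbal(n,(2t−1)K_2) = bal(n,2tK_2) = bal(n,(2t+1)K_2). -/
/-- The set of red edges of a 2-edge-colouring of `K_n`
    (`true` = red, `false` = blue). -/
def redEdges (n : ℕ) (c : Sym2 (Fin n) → Bool) : Finset (Sym2 (Fin n)) :=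
  (⊤ : SimpleGraph (Fin n)).edgeFinset.filter (fun e => c e = true)

/-- The set of blue edges of a 2-edge-colouring of `K_n`. -/
def blueEdges (n : ℕ) (c : Sym2 (Fin n) → Bool) : Finset (Sym2 (Fin n)) :=
  (⊤ : SimpleGraph (Fin n)).edgeFinset.filter (fun e => c e = false)

/-- A copy of the matching `mK_2` in a 2-edge-coloured `K_n` having exactly `r` red edges:
`m` pairwise vertex-disjoint edges, exactly `r` of which are red. -/
def MatchingCopy (n : ℕ) (c : Sym2 (Fin n) → Bool) (m r : ℕ) : Prop :=
  ∃ f : Fin m → Fin n × Fin n,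
    (Function.Injective fun p : Fin m × Bool => if p.2 then (f p.1).1 else (f p.1).2) ∧
    (Finset.univ.filter fun i : Fin m => c s((f i).1, (f i).2) = true).card = r

/-- `bal(n, mK_2)`: the least `k` such that every 2-edge-colouring of `K_n` with
`min{|R|,|B|} > k` contains a balanced copy of `mK_2`, i.e. one with `⌊m/2⌋` or `⌈m/2⌉`
red edges (these coincide for `m` even). -/
noncomputable def balMatching (n m : ℕ) : ℕ :=
  sInf {k : ℕ | ∀ c : Sym2 (Fin n) → Bool,
    k < min (redEdges n c).card (blueEdges n c).card →
    MatchingCopy n c m (m / 2) ∨ MatchingCopy n c m ((m + 1) / 2)}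

/-- `sbal(n, mK_2)` for odd `m`: the least `k` such that every 2-edge-colouring of `K_n`
with `min{|R|,|B|} > k` contains both a `(⌊m/2⌋,⌈m/2⌉)`-coloured and a
`(⌈m/2⌉,⌊m/2⌋)`-coloured copy of `mK_2`. -/
noncomputable def sbalMatching (n m : ℕ) : ℕ :=
  sInf {k : ℕ | ∀ c : Sym2 (Fin n) → Bool,
    k < min (redEdges n c).card (blueEdges n c).card →
    MatchingCopy n c m (m / 2) ∧ MatchingCopy n c m ((m + 1) / 2)}

/-- `ColouredMatching c X r b`: the vertex set `X` is perfectly matched by `r` red and `b` blue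
edges of the colouring `c`. -/
inductive ColouredMatching {V : Type*} [DecidableEq V] (c : Sym2 V → Bool) :
    Finset V → ℕ → ℕ → Prop
  | nil : ColouredMatching c ∅ 0 0
  | red {X : Finset V} {r b : ℕ} {u v : V} (huv : u ≠ v) (hu : u ∉ X) (hv : v ∉ X)
      (hc : c s(u, v) = true) (h : ColouredMatching c X r b) :
      ColouredMatching c (insert u (insert v X)) (r + 1) b
  | blue {X : Finset V} {r b : ℕ} {u v : V} (huv : u ≠ v) (hu : u ∉ X) (hv : v ∉ X)
      (hc : c s(u, v) = false) (h : ColouredMatching c X r b) :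
      ColouredMatching c (insert u (insert v X)) r (b + 1)

namespace ColouredMatching

variable {V : Type*} [DecidableEq V] {c : Sym2 V → Bool} {X Y : Finset V} {r b r' b' : ℕ}

theorem card_eq (h : ColouredMatching c X r b) : X.card = 2 * (r + b) := by
  induction h with
  | nil => rfl
  | red huv hu hv _ _ ih | blue huv hu hv _ _ ih =>
    rw [Finset.card_insert_of_notMem (by simp [huv, hu]), Finset.card_insert_of_notMem hv, ih]
    ring

theorem exists_subset (h : ColouredMatching c X r b) (hr : r' ≤ r) (hb : b' ≤ b) :
    ∃ X' ⊆ X, ColouredMatching c X' r' b' := by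
  induction h generalizing r' b' with
  | nil =>
    obtain rfl := Nat.le_zero.mp hr
    obtain rfl := Nat.le_zero.mp hb
    exact ⟨∅, subset_rfl, nil⟩
  | @red X r b u v huv hu hv hc h ih =>
    rcases Nat.le_succ_iff.mp hr with hr | rfl
    · obtain ⟨X', hX', h'⟩ := ih hr hb
      exact ⟨X', fun x hx => by simp [hX' hx], h'⟩
    · obtain ⟨X', hX', h'⟩ := ih le_rfl hb
      exact ⟨_, Finset.insert_subset_insert u (Finset.insert_subset_insert v hX'),
        red huv (fun hx => hu (hX' hx)) (fun hx => hv (hX' hx)) hc h'⟩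
  | @blue X r b u v huv hu hv hc h ih =>
    rcases Nat.le_succ_iff.mp hb with hb | rfl
    · obtain ⟨X', hX', h'⟩ := ih hr hb
      exact ⟨X', fun x hx => by simp [hX' hx], h'⟩
    · obtain ⟨X', hX', h'⟩ := ih hr le_rfl
      exact ⟨_, Finset.insert_subset_insert u (Finset.insert_subset_insert v hX'),
        blue huv (fun hx => hu (hX' hx)) (fun hx => hv (hX' hx)) hc h'⟩

theorem union (h : ColouredMatching c X r b) (h' : ColouredMatching c Y r' b')
    (hd : Disjoint X Y) : ColouredMatching c (X ∪ Y) (r + r') (b + b') := by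
  induction h with
  | nil => simpa using h'
  | red huv hu hv hc h ih =>
    simp only [Finset.disjoint_insert_left] at hd
    obtain ⟨h1, h2, hd⟩ := hd
    rw [Finset.insert_union, Finset.insert_union, Nat.add_right_comm]
    exact red huv (by simp [hu, h1]) (by simp [hv, h2]) hc (ih hd)
  | blue huv hu hv hc h ih =>
    simp only [Finset.disjoint_insert_left] at hd
    obtain ⟨h1, h2, hd⟩ := hd
    rw [Finset.insert_union, Finset.insert_union, Nat.add_right_comm]
    exact blue huv (by simp [hu, h1]) (by simp [hv, h2]) hc (ih hd)

theorem split (h : ColouredMatching c X r b) :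
    ∃ Y Z, Disjoint Y Z ∧ Y ∪ Z = X ∧ ColouredMatching c Y r 0 ∧ ColouredMatching c Z 0 b := by
  induction h with
  | nil => exact ⟨∅, ∅, by simp, by simp, nil, nil⟩
  | @red X r b u v huv hu hv hc h ih =>
    obtain ⟨Y, Z, hd, rfl, hY, hZ⟩ := ih
    simp only [Finset.mem_union, not_or] at hu hv
    refine ⟨insert u (insert v Y), Z, ?_, ?_, red huv hu.1 hv.1 hc hY, hZ⟩
    · simp [Finset.disjoint_insert_left, hu.2, hv.2, hd]
    · simp [Finset.insert_union]
  | @blue X r b u v huv hu hv hc h ih =>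
    obtain ⟨Y, Z, hd, rfl, hY, hZ⟩ := ih
    simp only [Finset.mem_union, not_or] at hu hv
    refine ⟨Y, insert u (insert v Z), ?_, ?_, hY, blue huv hu.2 hv.2 hc hZ⟩
    · simp [Finset.disjoint_insert_right, hu.1, hv.1, hd]
    · simp [Finset.union_insert]

theorem exists_subset_erase (h : ColouredMatching c X 0 b) (x : V) :
    ∃ X' ⊆ X.erase x, ColouredMatching c X' 0 (b - 1) := by
  generalize hr : 0 = r at h
  induction h with
  | nil => exact ⟨∅, by simp, hr ▸ nil⟩
  | red => omega
  | @blue X r b u v huv hu hv hc h ih =>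
    subst hr
    by_cases hx : x ∈ X
    · obtain ⟨X', hX', h'⟩ := ih rfl
      rcases b with _ | b
      · exact ⟨∅, by simp, nil⟩
      · refine ⟨insert u (insert v X'), ?_, blue huv (fun hu' => hu ?_) (fun hv' => hv ?_) hc h'⟩
        · grind
        · grind
        · grind
    · exact ⟨X, by grind, h⟩

theorem of_blue_clique {U : Finset V} (hU : ∀ u ∈ U, ∀ v ∈ U, u ≠ v → c s(u, v) = false)
    (hb : 2 * b ≤ U.card) : ∃ X ⊆ U, ColouredMatching c X 0 b := by
  induction b with
  | zero => exact ⟨∅, by simp, nil⟩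
  | succ b ih =>
    obtain ⟨X, hXU, hX⟩ := ih (by omega)
    have hcard := Finset.card_sdiff_add_card_eq_card hXU
    have hX' := hX.card_eq
    obtain ⟨u, hu, v, hv, huv⟩ := Finset.one_lt_card.mp (show 1 < (U \ X).card by omega)
    rw [Finset.mem_sdiff] at hu hv
    exact ⟨insert u (insert v X), by grind, blue huv hu.2 hv.2 (hU u hu.1 v hv.1 huv) hX⟩

/-- If every red edge meets `Y`, a red matching of size `r` has at most `r` vertices
outside `Y`. -/
theorem card_sdiff_le (h : ColouredMatching c X r 0)
    (hY : ∀ u ∉ Y, ∀ v ∉ Y, u ≠ v → c s(u, v) = false) : (X \ Y).card ≤ r := by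
  generalize hb : 0 = b at h
  induction h with
  | nil => simp
  | @red X r b u v huv hu hv hc h ih =>
    have ih := ih hb
    by_cases huY : u ∈ Y
    · rw [Finset.insert_sdiff_of_mem _ huY]
      by_cases hvY : v ∈ Y
      · rw [Finset.insert_sdiff_of_mem _ hvY]; omega
      · rw [Finset.insert_sdiff_of_notMem _ hvY]
        exact (Finset.card_insert_le _ _).trans (by omega)
    · have hvY : v ∈ Y := by
        by_contra hvY
        simp [hY u huY v hvY huv] at hc
      rw [Finset.insert_sdiff_of_notMem _ huY, Finset.insert_sdiff_of_mem _ hvY]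
      exact (Finset.card_insert_le _ _).trans (by omega)
  | blue => omega

theorem of_family {m : ℕ} (f : Fin m → V × V)
    (hf : Function.Injective fun p : Fin m × Bool => if p.2 then (f p.1).1 else (f p.1).2)
    (I : Finset (Fin m)) :
    ColouredMatching c (I.biUnion fun i => {(f i).1, (f i).2})
      (I.filter fun i => c s((f i).1, (f i).2) = true).card
      (I.filter fun i => ¬ c s((f i).1, (f i).2) = true).card := by
  induction I using Finset.induction_on with
  | empty => exact nil
  | @insert i I hi ih =>
    have huv : (f i).1 ≠ (f i).2 := fun h => by
      simpa using @hf (i, true) (i, false) (by simpa using h)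
    have hu : (f i).1 ∉ I.biUnion fun i => {(f i).1, (f i).2} := by
      simp only [Finset.mem_biUnion, Finset.mem_insert, Finset.mem_singleton, not_exists, not_and]
      rintro j hj (h | h)
      · have := @hf (i, true) (j, true) (by simpa using h)
        simp_all
      · have := @hf (i, true) (j, false) (by simpa using h)
        simp_all
    have hv : (f i).2 ∉ I.biUnion fun i => {(f i).1, (f i).2} := by
      simp only [Finset.mem_biUnion, Finset.mem_insert, Finset.mem_singleton, not_exists, not_and]
      rintro j hj (h | h)
      · have := @hf (i, false) (j, true) (by simpa using h)
        simp_all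
      · have := @hf (i, false) (j, false) (by simpa using h)
        simp_all
    have hX : (insert i I).biUnion (fun i => {(f i).1, (f i).2}) =
        insert (f i).1 (insert (f i).2 (I.biUnion fun i => {(f i).1, (f i).2})) := by
      simp [Finset.biUnion_insert, Finset.insert_union]
    rw [hX, Finset.filter_insert, Finset.filter_insert]
    cases hc : c s((f i).1, (f i).2)
    · simpa [hi] using blue huv hu hv hc ih
    · simpa [hi] using red huv hu hv hc ih

theorem exists_family (h : ColouredMatching c X r b) {m : ℕ} (hm : r + b = m) :
    ∃ f : Fin m → V × V, (∀ i, (f i).1 ∈ X ∧ (f i).2 ∈ X) ∧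
      (Function.Injective fun p : Fin m × Bool => if p.2 then (f p.1).1 else (f p.1).2) ∧
      (Finset.univ.filter fun i : Fin m => c s((f i).1, (f i).2) = true).card = r := by
  have cons_injective : ∀ {m : ℕ} {X : Finset V} {u v : V} {f : Fin m → V × V}, u ≠ v → u ∉ X →
      v ∉ X → (∀ i, (f i).1 ∈ X ∧ (f i).2 ∈ X) →
      (Function.Injective fun p : Fin m × Bool => if p.2 then (f p.1).1 else (f p.1).2) →
      Function.Injective fun p : Fin (m + 1) × Bool =>
        if p.2 then ((Fin.cons (u, v) f : Fin (m + 1) → V × V) p.1).1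
        else ((Fin.cons (u, v) f : Fin (m + 1) → V × V) p.1).2 := by
    rintro m X u v f huv hu hv hfX hf ⟨i, x⟩ ⟨j, y⟩ hij
    induction i using Fin.cases with
    | zero =>
      induction j using Fin.cases with
      | zero => cases x <;> cases y <;> simp_all
      | succ j => have := hfX j; cases x <;> cases y <;> simp at hij <;> grind
    | succ i =>
      induction j using Fin.cases with
      | zero => have := hfX i; cases x <;> cases y <;> simp at hij <;> grind
      | succ j =>
        have := @hf (i, x) (j, y) (by simpa using hij)
        simp_all
  induction h generalizing m with
  | nil =>
    subst hm
    exact ⟨Fin.elim0, fun i => i.elim0, fun p => p.1.elim0, rfl⟩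
  | @red X r b u v huv hu hv hc h ih =>
    obtain ⟨f, hfX, hf, hr⟩ := ih rfl
    obtain rfl : r + b + 1 = m := by omega
    refine ⟨Fin.cons (u, v) f, Fin.cases (by simp) (fun i => by simp [hfX i]),
      cons_injective huv hu hv hfX hf, ?_⟩
    rw [Finset.card_filter, Fin.sum_univ_succ]
    simp [hc, hr, add_comm]
  | @blue X r b u v huv hu hv hc h ih =>
    obtain ⟨f, hfX, hf, hr⟩ := ih rfl
    obtain rfl : r + b + 1 = m := by omega
    refine ⟨Fin.cons (u, v) f, Fin.cases (by simp) (fun i => by simp [hfX i]),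
      cons_injective huv hu hv hfX hf, ?_⟩
    rw [Finset.card_filter, Fin.sum_univ_succ]
    simp [hc, hr]

variable [Fintype V]

/-- A matching with `s` red and `s + 1` blue edges together with a red matching of size `s + 1`
yields a matching with `s + 1` edges of each colour, provided there are enough vertices. -/
theorem exists_balanced {s : ℕ} (hV : 5 * s + 7 ≤ Fintype.card V)
    (hX : ColouredMatching c X s (s + 1)) (hY : ColouredMatching c Y (s + 1) 0) :
    ∃ Z, ColouredMatching c Z (s + 1) (s + 1) := by
  by_contra hno
  obtain ⟨S, T, hd, rfl, hS, hT⟩ := hX.split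
  have hScard := hS.card_eq
  have hcard := hX.card_eq
  have hW : ∀ u ∉ S ∪ T, ∀ v ∉ S ∪ T, u ≠ v → c s(u, v) = false := by
    intro u hu v hv huv
    by_contra hc
    exact hno ⟨_, red huv hu hv (by simpa using hc) hX⟩
  have hS' : ∀ u ∉ S, ∀ v ∉ S, u ≠ v → c s(u, v) = false := by
    intro u hu v hv huv
    by_contra hc
    obtain ⟨T₁, hT₁, h₁⟩ := hT.exists_subset_erase u
    obtain ⟨T₂, hT₂, h₂⟩ := h₁.exists_subset_erase v
    have hUcard : Fintype.card V - (S ∪ T).card - 2 ≤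
        ((Finset.univ \ (S ∪ T)) \ {u, v}).card := by
      have h1 := Finset.le_card_sdiff {u, v} (Finset.univ \ (S ∪ T))
      have h2 := Finset.le_card_sdiff (S ∪ T) Finset.univ
      have h3 := Finset.card_le_two (a := u) (b := v)
      rw [Finset.card_univ] at h2
      omega
    obtain ⟨W, hWU, hW'⟩ := of_blue_clique (c := c) (b := s + 1 - (s + 1 - 1 - 1))
      (U := (Finset.univ \ (S ∪ T)) \ {u, v})
      (fun x hx y hy => hW x (by grind) y (by grind)) (by omega)
    have hTW : Disjoint T₂ W := by
      rw [Finset.disjoint_left]; grind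
    have hB := h₂.union hW' hTW
    have hdisj : Disjoint (insert u (insert v S)) (T₂ ∪ W) := by
      rw [Finset.disjoint_left] at hd ⊢; grind
    have hfin := (red huv hu hv (by simpa using hc) hS).union hB hdisj
    rw [show s + 1 + (0 + 0) = s + 1 by omega,
      show 0 + (s + 1 - 1 - 1 + (s + 1 - (s + 1 - 1 - 1))) = s + 1 by omega] at hfin
    exact hno ⟨_, hfin⟩
  have hle := hY.card_sdiff_le hS'
  have hUcard : 2 * (s + 1) ≤ (Finset.univ \ (S ∪ Y \ S)).card := by
    have h1 := Finset.le_card_sdiff (S ∪ Y \ S) Finset.univ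
    have h2 := Finset.card_union_le S (Y \ S)
    rw [Finset.card_univ] at h1
    omega
  obtain ⟨Z, hZU, hZ⟩ := of_blue_clique (c := c)
    (fun x hx y hy => hS' x (by grind) y (by grind)) hUcard
  have hYZ : Disjoint Y Z := by
    rw [Finset.disjoint_left]; grind
  exact hno ⟨_, by simpa using hY.union hZ hYZ⟩

theorem exists_extend (h : ColouredMatching c X r b)
    (hV : 2 * (r + b) + 2 ≤ Fintype.card V) :
    (∃ Z, ColouredMatching c Z (r + 1) b) ∨ ∃ Z, ColouredMatching c Z r (b + 1) := by
  have hX := h.card_eq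
  have hle := Finset.le_card_sdiff X Finset.univ
  rw [Finset.card_univ] at hle
  obtain ⟨u, hu, v, hv, huv⟩ := Finset.one_lt_card.mp (show 1 < (Finset.univ \ X).card by omega)
  simp only [Finset.mem_sdiff, Finset.mem_univ, true_and] at hu hv
  cases hc : c s(u, v)
  · exact .inr ⟨_, blue huv hu hv hc h⟩
  · exact .inl ⟨_, red huv hu hv hc h⟩

end ColouredMatching

theorem matchingCopy_iff {n : ℕ} {c : Sym2 (Fin n) → Bool} (r b : ℕ) :
    MatchingCopy n c (r + b) r ↔ ∃ X, ColouredMatching c X r b := by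
  constructor
  · rintro ⟨f, hf, hr⟩
    have hsum := Finset.card_filter_add_card_filter_not (s := Finset.univ)
      (fun i : Fin (r + b) => c s((f i).1, (f i).2) = true)
    have h := ColouredMatching.of_family (c := c) f hf Finset.univ
    rw [hr, Finset.card_univ, Fintype.card_fin, add_right_inj] at hsum
    rw [hr, hsum] at h
    exact ⟨_, h⟩
  · rintro ⟨X, h⟩
    obtain ⟨f, -, hf, hr⟩ := h.exists_family rfl
    exact ⟨f, hf, hr⟩

theorem matchingCopy_sub_one_iff {n s : ℕ} (hn : 5 * s + 7 ≤ n) (c : Sym2 (Fin n) → Bool) :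
    (MatchingCopy n c (s + (s + 1)) s ∧ MatchingCopy n c (s + 1 + s) (s + 1)) ↔
      MatchingCopy n c (s + 1 + (s + 1)) (s + 1) := by
  simp only [matchingCopy_iff]
  constructor
  · rintro ⟨⟨X, hX⟩, Y, hY⟩
    obtain ⟨Y', -, hY'⟩ := hY.exists_subset le_rfl (Nat.zero_le _)
    exact hX.exists_balanced (by simpa using hn) hY'
  · rintro ⟨X, hX⟩
    obtain ⟨Y, -, hY⟩ := hX.exists_subset (Nat.le_succ s) le_rfl
    obtain ⟨Z, -, hZ⟩ := hX.exists_subset le_rfl (Nat.le_succ s)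
    exact ⟨⟨Y, hY⟩, Z, hZ⟩

theorem matchingCopy_add_one_iff {n t : ℕ} (hn : 4 * t + 2 ≤ n) (c : Sym2 (Fin n) → Bool) :
    (MatchingCopy n c (t + (t + 1)) t ∨ MatchingCopy n c (t + 1 + t) (t + 1)) ↔
      MatchingCopy n c (t + t) t := by
  simp only [matchingCopy_iff]
  constructor
  · rintro (⟨X, hX⟩ | ⟨X, hX⟩)
    · obtain ⟨Y, -, hY⟩ := hX.exists_subset le_rfl (Nat.le_succ t)
      exact ⟨Y, hY⟩
    · obtain ⟨Y, -, hY⟩ := hX.exists_subset (Nat.le_succ t) le_rfl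
      exact ⟨Y, hY⟩
  · rintro ⟨X, hX⟩
    exact (hX.exists_extend (by simp only [Fintype.card_fin]; omega)).symm

theorem sbalMatching_eq_balMatching {n t : ℕ} (ht : 1 ≤ t) (hn : 5 * t + 2 ≤ n) :
    sbalMatching n (2 * t - 1) = balMatching n (2 * t) := by
  obtain ⟨s, rfl⟩ := Nat.exists_eq_add_of_le' ht
  have key := matchingCopy_sub_one_iff (n := n) (s := s) (by omega)
  rw [sbalMatching, balMatching, show (2 * (s + 1) - 1) / 2 = s by omega,
    show (2 * (s + 1) - 1 + 1) / 2 = s + 1 by omega, show 2 * (s + 1) / 2 = s + 1 by omega,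
    show (2 * (s + 1) + 1) / 2 = s + 1 by omega, show 2 * (s + 1) - 1 = s + 1 + s by omega,
    show 2 * (s + 1) = s + 1 + (s + 1) by omega]
  simp only [or_self, ← key, Nat.add_comm s (s + 1)]

theorem balMatching_even_eq_odd {n t : ℕ} (hn : 4 * t + 2 ≤ n) :
    balMatching n (2 * t) = balMatching n (2 * t + 1) := by
  have key := matchingCopy_add_one_iff hn
  rw [balMatching, balMatching, show 2 * t / 2 = t by omega,
    show (2 * t + 1) / 2 = t by omega, show (2 * t + 1 + 1) / 2 = t + 1 by omega,
    show 2 * t + 1 = t + 1 + t by omega, show 2 * t = t + t by omega]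
  simp only [or_self, ← key, Nat.add_comm t (t + 1)]

/-- For every `t ≥ 1` and every `n ≥ 5t+2`, `sbal(n, (2t-1)K_2) = bal(n, 2tK_2)`;
consequently the triple `((2t-1)K_2, 2tK_2, (2t+1)K_2)` has the triple property: there is
`n₀` such that for all `n ≥ n₀`,
`sbal(n, (2t-1)K_2) = bal(n, 2tK_2) = bal(n, (2t+1)K_2)`. -/
theorem matchings_triple_property (t : ℕ) (ht : 1 ≤ t) :
    (∀ n : ℕ, 5 * t + 2 ≤ n → sbalMatching n (2 * t - 1) = balMatching n (2 * t)) ∧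
    ∃ n₀ : ℕ, ∀ n : ℕ, n₀ ≤ n →
      sbalMatching n (2 * t - 1) = balMatching n (2 * t) ∧
      balMatching n (2 * t) = balMatching n (2 * t + 1) := by
  have h := fun n hn => sbalMatching_eq_balMatching (n := n) ht hn
  exact ⟨h, 5 * t + 2, fun n hn => ⟨h n hn, balMatching_even_eq_odd (by omega)⟩⟩
end

section
/- For every integer t ≥ 1 and every integer n ≥ 7t−1, bal(n, 2tK_2) ≥ ex(n, tK_2); indeed there is a 2-edge-colouring of K_n with min{|R|,|B|} = ex(n, tK_2), obtained by colouring red the edges of an extremal tK_2-free graph on n vertices and blue all remaining edges, which contains no copy of 2tK_2 with exactly t red and t blue edges. -/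
/-- A graph `A` contains a matching of `t` pairwise vertex-disjoint edges,
i.e. a copy of `tK_2`. -/
def HasMatching {N : ℕ} (A : SimpleGraph (Fin N)) (t : ℕ) : Prop :=
  ∃ f : Fin t → Fin N × Fin N,
    (Function.Injective fun p : Fin t × Bool => if p.2 then (f p.1).1 else (f p.1).2) ∧
    ∀ i : Fin t, A.Adj (f i).1 (f i).2

/-- The Turán number `ex(n, tK_2)`: the maximum number of edges of a graph on `n`
vertices containing no copy of the matching `tK_2`. -/
noncomputable def exMatching (n t : ℕ) : ℕ :=
  sSup {k : ℕ | ∃ A : SimpleGraph (Fin n), ¬ HasMatching A t ∧ A.edgeSet.ncard = k}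

theorem HasMatching.succ {N s : ℕ} {A : SimpleGraph (Fin N)} {f : Fin s → Fin N × Fin N}
    (hf : Function.Injective fun p : Fin s × Bool => if p.2 then (f p.1).1 else (f p.1).2)
    (hA : ∀ i, A.Adj (f i).1 (f i).2) {a b : Fin N} (hab : A.Adj a b)
    (ha : ∀ i, (f i).1 ≠ a ∧ (f i).2 ≠ a) (hb : ∀ i, (f i).1 ≠ b ∧ (f i).2 ≠ b) :
    HasMatching A (s + 1) := by
  refine ⟨Fin.cons (a, b) f, ?_, Fin.cases (by simpa using hab) (by simpa using hA)⟩
  have hne := hab.ne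
  rintro ⟨i, x⟩ ⟨j, y⟩ h
  cases i using Fin.cases with
  | zero =>
    cases j using Fin.cases with
    | zero => cases x <;> cases y <;> simp_all
    | succ j =>
      obtain ⟨h1, h2⟩ := ha j
      obtain ⟨h3, h4⟩ := hb j
      cases x <;> cases y <;> simp [h1.symm, h2.symm, h3.symm, h4.symm] at h
  | succ i =>
    cases j using Fin.cases with
    | zero =>
      have h1 := ha i
      have h2 := hb i
      cases x <;> cases y <;> simp_all
    | succ j =>
      have := @hf (i, x) (j, y) (by simpa using h)
      simp_all

/-- A graph without a matching of size `t` has an independent set on all but `2 (t - 1)` of its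
vertices: the vertices missed by a maximal matching. -/
theorem exists_independent_of_not_hasMatching {N t : ℕ} {A : SimpleGraph (Fin N)}
    (h : ¬ HasMatching A t) :
    ∃ U : Finset (Fin N), N ≤ U.card + 2 * (t - 1) ∧ ∀ a ∈ U, ∀ b ∈ U, ¬ A.Adj a b := by
  classical
  have h0 : HasMatching A 0 := ⟨Fin.elim0, fun p => p.1.elim0, fun i => i.elim0⟩
  obtain ⟨s, hst, ⟨f, hf, hA⟩, hs'⟩ :
      ∃ s, s < t ∧ HasMatching A s ∧ ¬ HasMatching A (s + 1) := by
    by_contra! hcon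
    have key : ∀ s, s ≤ t → HasMatching A s := by
      intro s
      induction s with
      | zero => exact fun _ => h0
      | succ s ih => exact fun hs => hcon s hs (ih (by omega))
    exact h (key t le_rfl)
  let S : Finset (Fin N) :=
    Finset.univ.image fun p : Fin s × Bool => if p.2 then (f p.1).1 else (f p.1).2
  have hS : S.card ≤ 2 * s := by
    refine Finset.card_image_le.trans ?_
    simp [mul_comm]
  have hmem : ∀ a ∈ Sᶜ, ∀ i, (f i).1 ≠ a ∧ (f i).2 ≠ a := by
    intro a ha i
    simp only [S, Finset.mem_compl, Finset.mem_image, Finset.mem_univ, true_and, not_exists] at ha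
    exact ⟨by simpa using ha (i, true), by simpa using ha (i, false)⟩
  refine ⟨Sᶜ, ?_, fun a ha b hb hab => hs' (HasMatching.succ hf hA hab (hmem a ha) (hmem b hb))⟩
  rw [Finset.card_compl, Fintype.card_fin]
  omega

theorem exists_extremal_hasMatching (n : ℕ) {t : ℕ} (ht : 1 ≤ t) :
    ∃ A : SimpleGraph (Fin n), ¬ HasMatching A t ∧ A.edgeSet.ncard = exMatching n t := by
  refine Nat.sSup_mem (s := {k : ℕ | ∃ A : SimpleGraph (Fin n),
    ¬ HasMatching A t ∧ A.edgeSet.ncard = k}) ⟨_, ⊥, ?_, rfl⟩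
    ⟨(Set.univ : Set (Sym2 (Fin n))).ncard, ?_⟩
  · rintro ⟨f, -, hf⟩
    exact hf ⟨0, ht⟩
  · rintro k ⟨A, -, rfl⟩
    exact Set.ncard_le_ncard (Set.subset_univ _)

theorem HasMatching.of_matchingCopy {n m t : ℕ} {c : Sym2 (Fin n) → Bool}
    {A : SimpleGraph (Fin n)}
    (hc : ∀ e ∈ (⊤ : SimpleGraph (Fin n)).edgeFinset, c e = true → e ∈ A.edgeSet)
    (h : MatchingCopy n c m t) : HasMatching A t := by
  obtain ⟨f, hf, hcard⟩ := h
  let g := Finset.orderEmbOfFin _ hcard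
  refine ⟨fun i => f (g i), ?_, fun i => ?_⟩
  · rintro ⟨i, x⟩ ⟨j, y⟩ hij
    have := @hf (g i, x) (g j, y) hij
    simpa using this
  · have hi := Finset.orderEmbOfFin_mem _ hcard i
    have hne : (f (g i)).1 ≠ (f (g i)).2 := fun heq => by
      simpa using @hf (g i, true) (g i, false) (by simpa using heq)
    exact hc s((f (g i)).1, (f (g i)).2) (by simpa using hne) (Finset.mem_filter.1 hi).2

theorem card_redEdges_add_card_blueEdges (n : ℕ) (c : Sym2 (Fin n) → Bool) :
    (redEdges n c).card + (blueEdges n c).card = n.choose 2 := by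
  have h := Finset.card_filter_add_card_filter_not
    (s := (⊤ : SimpleGraph (Fin n)).edgeFinset) (fun e => c e = true)
  rw [SimpleGraph.card_edgeFinset_top_eq_card_choose_two, Fintype.card_fin] at h
  simpa [redEdges, blueEdges] using h

theorem choose_two_le_card_blueEdges {n : ℕ} {c : Sym2 (Fin n) → Bool} {U : Finset (Fin n)}
    (hU : ∀ a ∈ U, ∀ b ∈ U, a ≠ b → c s(a, b) = false) :
    U.card.choose 2 ≤ (blueEdges n c).card := by
  rw [← Sym2.card_image_offDiag]
  refine Finset.card_le_card fun e he => ?_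
  obtain ⟨⟨a, b⟩, hab, rfl⟩ := Finset.mem_image.1 he
  obtain ⟨ha, hb, hne⟩ := Finset.mem_offDiag.1 hab
  exact Finset.mem_filter.2 ⟨by simpa using hne, hU a ha b hb hne⟩

theorem choose_two_le_two_mul_choose_two {n t u : ℕ} (ht : 1 ≤ t) (hn : 7 * t - 1 ≤ n)
    (hu : n ≤ u + 2 * (t - 1)) : n.choose 2 ≤ 2 * u.choose 2 := by
  obtain ⟨t, rfl⟩ := Nat.exists_eq_add_of_le' ht
  obtain ⟨d, rfl⟩ := Nat.exists_eq_add_of_le' hn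
  have hmono : (5 * t + 6 + d).choose 2 ≤ u.choose 2 := Nat.choose_le_choose 2 (by omega)
  refine le_trans ?_ (Nat.mul_le_mul_left 2 hmono)
  rw [show d + (7 * (t + 1) - 1) = 7 * t + 6 + d by omega]
  rw [← Nat.cast_le (α := ℚ)]
  push_cast [Nat.cast_choose_two]
  have ht0 : (0 : ℚ) ≤ t := Nat.cast_nonneg t
  have hd0 : (0 : ℚ) ≤ d := Nat.cast_nonneg d
  nlinarith [mul_nonneg ht0 hd0, mul_nonneg ht0 ht0, mul_nonneg hd0 hd0]

/-- For every `t ≥ 1` and `n ≥ 7t-1`, `bal(n, 2tK_2) ≥ ex(n, tK_2)`: indeed, there is an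
extremal `tK_2`-free graph `A` on `n` vertices and a 2-edge-colouring of `K_n` colouring
exactly the edges of `A` red and all remaining edges blue, which has
`min{|R|,|B|} = ex(n, tK_2)` and contains no copy of `2tK_2` with exactly `t` red and `t`
blue edges. -/
theorem bal_matching_lower_bound (t : ℕ) (ht : 1 ≤ t) (n : ℕ) (hn : 7 * t - 1 ≤ n) :
    exMatching n t ≤ balMatching n (2 * t) ∧
    ∃ A : SimpleGraph (Fin n), ¬ HasMatching A t ∧ A.edgeSet.ncard = exMatching n t ∧
      ∃ c : Sym2 (Fin n) → Bool,
        (∀ e ∈ (⊤ : SimpleGraph (Fin n)).edgeFinset, c e = true ↔ e ∈ A.edgeSet) ∧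
        min (redEdges n c).card (blueEdges n c).card = exMatching n t ∧
        ¬ MatchingCopy n c (2 * t) t := by
  classical
  obtain ⟨A, hA, hcard⟩ := exists_extremal_hasMatching n ht
  let c : Sym2 (Fin n) → Bool := fun e => decide (e ∈ A.edgeSet)
  have hc : ∀ e, c e = true ↔ e ∈ A.edgeSet := fun e => decide_eq_true_iff
  have hcopy : ¬ MatchingCopy n c (2 * t) t := fun h =>
    hA (HasMatching.of_matchingCopy (fun e _ => (hc e).1) h)
  have hred : (redEdges n c).card = exMatching n t := by
    rw [← hcard, ← Set.ncard_coe_finset]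
    congr 1
    ext e
    simp only [redEdges, Finset.coe_filter, Set.mem_ofPred_eq, hc, SimpleGraph.mem_edgeFinset]
    exact ⟨And.right, fun he => ⟨SimpleGraph.edgeSet_mono le_top he, he⟩⟩
  obtain ⟨U, hUcard, hU⟩ := exists_independent_of_not_hasMatching hA
  have hblue : U.card.choose 2 ≤ (blueEdges n c).card :=
    choose_two_le_card_blueEdges fun a ha b hb _ => by simpa [c] using hU a ha b hb
  have hmin : min (redEdges n c).card (blueEdges n c).card = exMatching n t := by
    have h1 := card_redEdges_add_card_blueEdges n c
    have h2 := choose_two_le_two_mul_choose_two ht hn hUcard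
    omega
  refine ⟨?_, A, hA, hcard, c, fun e _ => hc e, hmin, hcopy⟩
  refine le_csInf ⟨n.choose 2, fun c' h => ?_⟩ fun k hk => ?_
  · have := card_redEdges_add_card_blueEdges n c'
    omega
  · by_contra! hlt
    have h := hk c (hmin ▸ hlt)
    rw [show 2 * t / 2 = t by omega, show (2 * t + 1) / 2 = t by omega] at h
    exact hcopy (h.elim id id)
end
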